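/- Define ψ(g) = |x|^2 / |(x,t)|^2 for 0 ≠ g = (x,t) ∈ H^n, where |(x,t)| = (|x|^4 + |t|^2)^{1/4}. Let 1 < q < ∞ and −Q/q < β < ∞. Then the function g ↦ |g|^β ψ(g) belongs to the reverse Hölder class B_q: there is a constant C such that (|B|^{-1} ∫_B (|g|^β ψ(g))^q dg)^{1/q} ≤ C |B|^{-1} ∫_B |g|^β ψ(g) dg for every ball B ⊂ H^n. -/

import Mathlib

open MeasureTheory Real

/-- The Heisenberg group `ℍⁿ`, identified with `ℝⁿ × ℝⁿ × ℝ`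
(so that `x_{n+j}` of the paper is the second factor). -/
abbrev Hn (n : ℕ) := (Fin n → ℝ) × (Fin n → ℝ) × ℝ

namespace Heisenberg

variable {n : ℕ}

/-- Group multiplication on the Heisenberg group. -/
noncomputable def hmul (g h : Hn n) : Hn n :=
  (g.1 + h.1, g.2.1 + h.2.1,
    g.2.2 + h.2.2 + 2 * ∑ j, (g.2.1 j * h.1 j - g.1 j * h.2.1 j))

/-- Group inverse on the Heisenberg group. -/
def hinv (g : Hn n) : Hn n := (-g.1, -g.2.1, -g.2.2)

/-- The homogeneous norm `|(x,t)| = (|x|⁴ + |t|²)^{1/4}`. -/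
noncomputable def hnorm (g : Hn n) : ℝ :=
  ((∑ j, g.1 j ^ 2 + ∑ j, g.2.1 j ^ 2) ^ 2 + g.2.2 ^ 2) ^ ((1 : ℝ) / 4)

/-- Left-invariant distance `d(g,h) = |g⁻¹ h|`. -/
noncomputable def dist' (g h : Hn n) : ℝ := hnorm (hmul (hinv g) h)

/-- The ball `B(g,r)` for the left-invariant distance. -/
def ball (g : Hn n) (r : ℝ) : Set (Hn n) := {h | dist' g h < r}

/-- The homogeneous dimension `Q = 2n + 2`. -/
noncomputable def Qd (n : ℕ) : ℝ := 2 * n + 2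

/-- Anisotropic dilations `δ_r(x,t) = (r x, r² t)`. -/
noncomputable def hdil (r : ℝ) (g : Hn n) : Hn n := (r • g.1, r • g.2.1, r ^ 2 * g.2.2)

/-- The function `ψ(g) = |x|²/|g|²`. -/
noncomputable def psi (g : Hn n) : ℝ :=
  (∑ j, g.1 j ^ 2 + ∑ j, g.2.1 j ^ 2) / hnorm g ^ 2

/-- The reverse Hölder class `B_q`: `V` is nonnegative, locally `L^q`, and satisfies
`(|B|⁻¹ ∫_B V^q)^{1/q} ≤ C |B|⁻¹ ∫_B V` uniformly over all balls. -/
def RevHolder (n : ℕ) (V : Hn n → ℝ) (q : ℝ) : Prop :=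
  (∀ g, 0 ≤ V g) ∧
  (∀ (g : Hn n) (r : ℝ), 0 < r → IntegrableOn (fun h => V h ^ q) (ball g r) volume) ∧
  (∀ (g : Hn n) (r : ℝ), 0 < r → IntegrableOn V (ball g r) volume) ∧
  ∃ C > 0, ∀ (g : Hn n) (r : ℝ), 0 < r →
    (((volume (ball g r)).toReal)⁻¹ * ∫ h in ball g r, V h ^ q) ^ (1 / q) ≤
      C * (((volume (ball g r)).toReal)⁻¹ * ∫ h in ball g r, V h)

/-- The auxiliary function `ρ(g) = sup { r > 0 : r^{-(Q-2)} ∫_{B(g,r)} V ≤ 1 }`. -/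
noncomputable def rho (V : Hn n → ℝ) (g : Hn n) : ℝ :=
  sSup {r : ℝ | 0 < r ∧ r ^ (-(Qd n - 2)) * ∫ h in ball g r, V h ≤ 1}

end Heisenberg

namespace Heisenberg

variable {n : ℕ}

/-- The squared Euclidean length `|x|²` of the horizontal part. -/
def horSq (g : Hn n) : ℝ := ∑ j, g.1 j ^ 2 + ∑ j, g.2.1 j ^ 2

/-- The square `|g|²` of the homogeneous norm. -/
noncomputable def gaugeSq (g : Hn n) : ℝ := √(horSq g ^ 2 + g.2.2 ^ 2)

lemma horSq_nonneg (g : Hn n) : 0 ≤ horSq g := by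
  unfold horSq; positivity

lemma gaugeSq_nonneg (g : Hn n) : 0 ≤ gaugeSq g := Real.sqrt_nonneg _

lemma horSq_le_gaugeSq (g : Hn n) : horSq g ≤ gaugeSq g :=
  Real.le_sqrt_of_sq_le (by nlinarith [sq_nonneg g.2.2])

lemma abs_snd_le_gaugeSq (g : Hn n) : |g.2.2| ≤ gaugeSq g :=
  Real.le_sqrt_of_sq_le (by rw [sq_abs]; nlinarith [sq_nonneg (horSq g)])

lemma gaugeSq_le_add (g : Hn n) : gaugeSq g ≤ horSq g + |g.2.2| := by
  refine Real.sqrt_le_iff.2 ⟨by have := horSq_nonneg g; positivity, ?_⟩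
  nlinarith [sq_abs g.2.2, mul_nonneg (horSq_nonneg g) (abs_nonneg g.2.2)]

lemma sq_fst_le_gaugeSq (g : Hn n) (j : Fin n) : g.1 j ^ 2 ≤ gaugeSq g := by
  refine le_trans ?_ (horSq_le_gaugeSq g)
  have h1 := Finset.single_le_sum (fun i _ => sq_nonneg (g.1 i)) (Finset.mem_univ j)
  have h2 : 0 ≤ ∑ j, g.2.1 j ^ 2 := by positivity
  unfold horSq; linarith

lemma sq_snd_le_gaugeSq (g : Hn n) (j : Fin n) : g.2.1 j ^ 2 ≤ gaugeSq g := by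
  refine le_trans ?_ (horSq_le_gaugeSq g)
  have h1 := Finset.single_le_sum (fun i _ => sq_nonneg (g.2.1 i)) (Finset.mem_univ j)
  have h2 : 0 ≤ ∑ j, g.1 j ^ 2 := by positivity
  unfold horSq; linarith

lemma hnorm_eq (g : Hn n) : hnorm g = gaugeSq g ^ (1 / 2 : ℝ) := by
  unfold hnorm gaugeSq horSq
  rw [Real.sqrt_eq_rpow, ← Real.rpow_mul (by positivity)]
  norm_num

lemma hnorm_nonneg (g : Hn n) : 0 ≤ hnorm g := by
  rw [hnorm_eq]; exact Real.rpow_nonneg (gaugeSq_nonneg g) _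

lemma hnorm_sq (g : Hn n) : hnorm g ^ 2 = gaugeSq g := by
  rw [hnorm_eq, ← Real.rpow_natCast, ← Real.rpow_mul (gaugeSq_nonneg g)]
  norm_num

lemma hnorm_rpow_mul_psi (β : ℝ) (g : Hn n) :
    hnorm g ^ β * psi g = gaugeSq g ^ (β / 2 - 1) * horSq g := by
  have hpsi : psi g = horSq g / gaugeSq g := by rw [← hnorm_sq]; rfl
  rw [hpsi, hnorm_eq, ← Real.rpow_mul (gaugeSq_nonneg g)]
  rcases (gaugeSq_nonneg g).eq_or_lt with h | h
  · have : horSq g = 0 := le_antisymm (h ▸ horSq_le_gaugeSq g) (horSq_nonneg g)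
    simp [this]
  · rw [Real.rpow_sub h, Real.rpow_one, one_div_mul_eq_div]
    field_simp

lemma continuous_horSq : Continuous (horSq : Hn n → ℝ) := by
  unfold horSq; fun_prop

lemma continuous_gaugeSq : Continuous (gaugeSq : Hn n → ℝ) := by
  have := continuous_horSq (n := n)
  unfold gaugeSq; fun_prop

lemma continuous_hmul (g : Hn n) : Continuous (hmul g) := by
  unfold hmul; fun_prop

lemma hmul_hinv_cancel_left (g h : Hn n) : hmul g (hmul (hinv g) h) = h := by
  refine Prod.ext ?_ (Prod.ext ?_ ?_)
  · simp [hmul, hinv]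
  · simp [hmul, hinv]
  · simp only [hmul, hinv, Pi.add_apply, Pi.neg_apply]
    have : ∑ j, (-g.2.1 j * h.1 j - -g.1 j * h.2.1 j) +
        ∑ j, (g.2.1 j * (-g.1 j + h.1 j) - g.1 j * (-g.2.1 j + h.2.1 j)) = 0 := by
      rw [← Finset.sum_add_distrib]
      exact Finset.sum_eq_zero fun j _ => by ring
    linarith

lemma hinv_hmul_cancel_left (g h : Hn n) : hmul (hinv g) (hmul g h) = h := by
  have := hmul_hinv_cancel_left (hinv g) h
  rwa [show hinv (hinv g) = g by simp [hinv]] at this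

lemma hmul_neg_cancel_right (g h : Hn n) : hmul (hmul g h) (-h) = g := by
  refine Prod.ext ?_ (Prod.ext ?_ ?_)
  · simp [hmul]
  · simp [hmul]
  · simp only [hmul, Pi.add_apply, Pi.neg_apply, Prod.fst_neg, Prod.snd_neg]
    have : ∑ j, (g.2.1 j * h.1 j - g.1 j * h.2.1 j) +
        ∑ j, ((g.2.1 j + h.2.1 j) * -h.1 j - (g.1 j + h.1 j) * -h.2.1 j) = 0 := by
      rw [← Finset.sum_add_distrib]
      exact Finset.sum_eq_zero fun j _ => by ring
    linarith

lemma horSq_neg (g : Hn n) : horSq (-g) = horSq g := by simp [horSq]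

lemma gaugeSq_neg (g : Hn n) : gaugeSq (-g) = gaugeSq g := by simp [gaugeSq, horSq_neg]

lemma horSq_hmul_add_horSq_hmul_neg (g h : Hn n) :
    horSq (hmul g h) + horSq (hmul g (-h)) = 2 * horSq g + 2 * horSq h := by
  simp only [horSq, hmul, Pi.add_apply, Pi.neg_apply, Prod.fst_neg, Prod.snd_neg, mul_add,
    Finset.mul_sum]
  have e (a b : Fin n → ℝ) : ∑ j, (a j + b j) ^ 2 + ∑ j, (a j + -b j) ^ 2 =
      ∑ j, 2 * a j ^ 2 + ∑ j, 2 * b j ^ 2 := by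
    simp only [← Finset.sum_add_distrib]
    exact Finset.sum_congr rfl fun j _ => by ring
  linarith [e g.1 h.1, e g.2.1 h.2.1]

lemma horSq_hmul_le (g h : Hn n) : horSq (hmul g h) ≤ 2 * horSq g + 2 * horSq h := by
  linarith [horSq_hmul_add_horSq_hmul_neg g h, horSq_nonneg (hmul g (-h))]

lemma gaugeSq_hmul_le (g h : Hn n) : gaugeSq (hmul g h) ≤ 4 * (gaugeSq g + gaugeSq h) := by
  have h1 := gaugeSq_le_add (hmul g h)
  have h2 := horSq_hmul_le g h
  have h3 : |2 * ∑ j, (g.2.1 j * h.1 j - g.1 j * h.2.1 j)| ≤ horSq g + horSq h := by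
    rw [Finset.mul_sum]
    refine (Finset.abs_sum_le_sum_abs _ _).trans ?_
    simp only [horSq, ← Finset.sum_add_distrib]
    refine Finset.sum_le_sum fun j _ => abs_le.2 ⟨?_, ?_⟩
    · nlinarith [sq_nonneg (g.2.1 j + h.1 j), sq_nonneg (g.1 j - h.2.1 j)]
    · nlinarith [sq_nonneg (g.2.1 j - h.1 j), sq_nonneg (g.1 j + h.2.1 j)]
  have h4 : |(hmul g h).2.2| ≤ |g.2.2| + |h.2.2| + (horSq g + horSq h) :=
    (abs_add_three _ _ _).trans (by gcongr)
  linarith [abs_snd_le_gaugeSq g, abs_snd_le_gaugeSq h, horSq_le_gaugeSq g, horSq_le_gaugeSq h]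

lemma gaugeSq_le_hmul (g h : Hn n) : gaugeSq g ≤ 4 * (gaugeSq (hmul g h) + gaugeSq h) := by
  have := gaugeSq_hmul_le (hmul g h) (-h)
  rwa [hmul_neg_cancel_right, gaugeSq_neg] at this

lemma horSq_hdil (r : ℝ) (g : Hn n) : horSq (hdil r g) = r ^ 2 * horSq g := by
  simp [horSq, hdil, mul_pow, mul_add, Finset.mul_sum]

lemma gaugeSq_hdil (r : ℝ) (g : Hn n) : gaugeSq (hdil r g) = r ^ 2 * gaugeSq g := by
  unfold gaugeSq
  rw [horSq_hdil, ← Real.sqrt_sq (sq_nonneg r), ← Real.sqrt_mul (sq_nonneg _),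
    Real.sqrt_sq (sq_nonneg r)]
  congr 1
  simp [hdil]
  ring

lemma hinv_hdil_hmul_hdil (r : ℝ) (g h : Hn n) :
    hmul (hinv (hdil r g)) (hdil r (hmul g h)) = hdil r h := by
  rw [← hinv_hmul_cancel_left (hdil r g) (hdil r h)]
  congr 1
  refine Prod.ext ?_ (Prod.ext ?_ ?_)
  · simp [hmul, hdil]
  · simp [hmul, hdil]
  · simp only [hmul, hdil, Pi.smul_apply, smul_eq_mul, mul_add, Finset.mul_sum]
    congr 1
    exact Finset.sum_congr rfl fun j _ => by ring

lemma measurePreserving_hmul (g : Hn n) : MeasurePreserving (hmul g) volume volume := by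
  have key (a : Fin n → ℝ) : MeasurePreserving (fun p : (Fin n → ℝ) × ℝ =>
      (g.2.1 + p.1, g.2.2 + p.2 + 2 * ∑ j, (g.2.1 j * a j - g.1 j * p.1 j)))
      volume volume := by
    refine (measurePreserving_add_left volume g.2.1).skew_product
      (g := fun y t => g.2.2 + t + 2 * ∑ j, (g.2.1 j * a j - g.1 j * y j))
      (by fun_prop) (.of_forall fun y => ?_)
    have := measurePreserving_add_left (volume : Measure ℝ)
      (g.2.2 + 2 * ∑ j, (g.2.1 j * a j - g.1 j * y j))
    refine Eq.trans ?_ this.map_eq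
    congr 1
    ext t
    ring
  refine (measurePreserving_add_left volume g.1).skew_product
    (g := fun a (p : (Fin n → ℝ) × ℝ) =>
      (g.2.1 + p.1, g.2.2 + p.2 + 2 * ∑ j, (g.2.1 j * a j - g.1 j * p.1 j)))
    (by fun_prop) (.of_forall fun a => (key a).map_eq)

instance : (volume : Measure (Hn n)).IsAddHaarMeasure :=
  haveI : (volume : Measure ((Fin n → ℝ) × ℝ)).IsAddHaarMeasure :=
    Measure.prod.instIsAddHaarMeasure _ _
  Measure.prod.instIsAddHaarMeasure _ _

lemma exists_map_hdil {r : ℝ} (hr : 0 < r) :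
    ∃ c > 0, (volume : Measure (Hn n)).map (hdil r) = ENNReal.ofReal c • volume := by
  let L : Hn n →ₗ[ℝ] Hn n :=
    { toFun := hdil r
      map_add' := fun g h => by
        simp [hdil, mul_add]
      map_smul' := fun a g => by
        simp only [hdil, Prod.smul_fst, Prod.smul_snd, smul_eq_mul, RingHom.id_apply,
          Prod.smul_mk, smul_comm r a, mul_left_comm] }
  have hL : LinearMap.det L ≠ 0 := by
    refine (LinearMap.isUnit_det L ((LinearMap.isUnit_iff_ker_eq_bot L).2 ?_)).ne_zero
    refine LinearMap.ker_eq_bot'.2 fun g hg => ?_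
    have hg' : hdil r g = 0 := hg
    simpa [hdil, Prod.ext_iff, hr.ne'] using hg'
  exact ⟨|(LinearMap.det L)⁻¹|, by positivity,
    Measure.map_linearMap_addHaar_eq_smul_addHaar volume hL⟩

lemma integrable_indicator_abs_rpow {σ R : ℝ} (hσ : -1 < σ) (hR : 0 < R) :
    Integrable ((Set.Ioo (-R) R).indicator fun x : ℝ => |x| ^ σ) := by
  rw [integrable_indicator_iff measurableSet_Ioo]
  have h1 : IntegrableOn (fun x : ℝ => |x| ^ σ) (Set.Ioo 0 R) :=
    ((intervalIntegral.integrableOn_Ioo_rpow_iff hR).2 hσ).congr_fun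
      (fun x hx => by rw [abs_of_pos hx.1]) measurableSet_Ioo
  have h2 : IntegrableOn (fun x : ℝ => |x| ^ σ) (Set.Ioo (-R) 0) := by
    have := (Measure.measurePreserving_neg (volume : Measure ℝ)).integrableOn_comp_preimage
      (Homeomorph.neg ℝ).measurableEmbedding (f := fun x : ℝ => |x| ^ σ) (s := Set.Ioo 0 R)
    simpa [Function.comp_def] using this.2 h1
  have h3 : IntegrableOn (fun x : ℝ => |x| ^ σ) {0} := by simp
  refine ((h2.union h3).union h1).mono_set fun x hx => ?_
  rcases lt_trichotomy x 0 with h | h | h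
  · exact .inl (.inl ⟨hx.1, h⟩)
  · exact .inl (.inr h)
  · exact .inr ⟨h, hx.2⟩

lemma ae_coords_ne_zero :
    ∀ᵐ g : Hn n, (∀ j, g.1 j ≠ 0) ∧ (∀ j, g.2.1 j ≠ 0) ∧ g.2.2 ≠ 0 := by
  have hpi : ∀ᵐ x : Fin n → ℝ, ∀ j, x j ≠ 0 :=
    ae_all_iff.2 fun j => Measure.ae_eval_ne _ j 0
  have h0 : ∀ᵐ t : ℝ, t ≠ 0 := by simp [ae_iff]
  have h1 := (Measure.quasiMeasurePreserving_fst
    (μ := (volume : Measure (Fin n → ℝ))) (ν := (volume : Measure ((Fin n → ℝ) × ℝ)))).ae hpi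
  have hsnd := Measure.quasiMeasurePreserving_snd
    (μ := (volume : Measure (Fin n → ℝ))) (ν := (volume : Measure ((Fin n → ℝ) × ℝ)))
  have h2 := hsnd.ae ((Measure.quasiMeasurePreserving_fst
    (μ := (volume : Measure (Fin n → ℝ))) (ν := (volume : Measure ℝ))).ae hpi)
  have h3 := hsnd.ae ((Measure.quasiMeasurePreserving_snd
    (μ := (volume : Measure (Fin n → ℝ))) (ν := (volume : Measure ℝ))).ae h0)
  filter_upwards [h1, h2, h3] with g a b c using ⟨a, b, c⟩

lemma integrable_coord_prod {f : ℝ → ℝ} (hf : Integrable f) :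
    Integrable fun g : Hn n => (∏ j, f (g.1 j)) * ((∏ j, f (g.2.1 j)) * f g.2.2) := by
  have h : Integrable fun x : Fin n → ℝ => ∏ j, f (x j) := Integrable.fintype_prod fun _ => hf
  exact h.mul_prod (h.mul_prod hf)

lemma isOpen_gaugeSq_lt (K : ℝ) : IsOpen {g : Hn n | gaugeSq g < K} :=
  isOpen_lt continuous_gaugeSq continuous_const

lemma integrableOn_gaugeSq_rpow_of_nonpos {s K : ℝ} (hs : -(n + 1 : ℝ) < s) (hs0 : s ≤ 0)
    (hK : 0 < K) :
    IntegrableOn (fun g : Hn n => gaugeSq g ^ s) {g | gaugeSq g < K} := by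
  set σ : ℝ := s / (n + 1) with hσ
  have hn : (0 : ℝ) < n + 1 := by positivity
  have hσ1 : -1 < σ := by rw [hσ, lt_div_iff₀ hn]; linarith
  have hσ0 : σ ≤ 0 := div_nonpos_of_nonpos_of_nonneg hs0 hn.le
  have hint := integrable_coord_prod (n := n)
    (integrable_indicator_abs_rpow hσ1 (R := K + 1) (by linarith))
  refine Integrable.mono' hint.integrableOn
    (continuous_gaugeSq.measurable.pow_const s).aestronglyMeasurable ?_
  filter_upwards [ae_restrict_mem (isOpen_gaugeSq_lt K).measurableSet,
    ae_restrict_of_ae ae_coords_ne_zero] with g hg ⟨hx, hy, ht⟩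
  have hgK : gaugeSq g < K := hg
  have hpos : 0 < gaugeSq g := (abs_pos.2 ht).trans_le (abs_snd_le_gaugeSq g)
  rw [Real.norm_of_nonneg (Real.rpow_nonneg hpos.le _)]
  have coord {a : ℝ} (ha : a ≠ 0) (h : a ^ 2 ≤ gaugeSq g) :
      √(gaugeSq g) ^ σ ≤ (Set.Ioo (-(K + 1)) (K + 1)).indicator (fun x : ℝ => |x| ^ σ) a := by
    have hmem : a ∈ Set.Ioo (-(K + 1)) (K + 1) :=
      abs_lt.1 (by nlinarith [sq_abs a, abs_nonneg a])
    rw [Set.indicator_of_mem hmem]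
    exact Real.rpow_le_rpow_of_nonpos (abs_pos.2 ha) (Real.abs_le_sqrt h) hσ0
  have coordT : gaugeSq g ^ σ ≤
      (Set.Ioo (-(K + 1)) (K + 1)).indicator (fun x : ℝ => |x| ^ σ) g.2.2 := by
    have h := abs_snd_le_gaugeSq g
    have hmem : g.2.2 ∈ Set.Ioo (-(K + 1)) (K + 1) := abs_lt.1 (by linarith)
    rw [Set.indicator_of_mem hmem]
    exact Real.rpow_le_rpow_of_nonpos (abs_pos.2 ht) h hσ0
  have hroot : 0 ≤ √(gaugeSq g) ^ σ := by positivity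
  have prodX := Finset.prod_le_prod (s := Finset.univ) (fun j _ => hroot)
    fun j _ => coord (hx j) (sq_fst_le_gaugeSq g j)
  have prodY := Finset.prod_le_prod (s := Finset.univ) (fun j _ => hroot)
    fun j _ => coord (hy j) (sq_snd_le_gaugeSq g j)
  rw [Finset.prod_const, Finset.card_univ, Fintype.card_fin] at prodX prodY
  have split : gaugeSq g ^ s =
      (√(gaugeSq g) ^ σ) ^ n * ((√(gaugeSq g) ^ σ) ^ n * gaugeSq g ^ σ) := by
    have hs' : s = σ * n + σ := by rw [hσ]; field_simp
    rw [← mul_assoc, ← mul_pow, ← Real.mul_rpow (by positivity) (by positivity),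
      Real.mul_self_sqrt hpos.le, hs', Real.rpow_add hpos, Real.rpow_mul hpos.le,
      Real.rpow_natCast]
  rw [split]
  have h0 : 0 ≤ gaugeSq g ^ σ := by positivity
  have hn0 : 0 ≤ (√(gaugeSq g) ^ σ) ^ n := by positivity
  exact mul_le_mul prodX (mul_le_mul prodY coordT h0 (hn0.trans prodY))
    (mul_nonneg hn0 h0) (hn0.trans prodX)

lemma volume_gaugeSq_lt_ne_top (K : ℝ) : volume {g : Hn n | gaugeSq g < K} ≠ ⊤ := by
  rcases le_or_gt K 0 with h | h
  · have : {g : Hn n | gaugeSq g < K} = ∅ :=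
      Set.eq_empty_of_forall_notMem fun g hg => absurd (gaugeSq_nonneg g) (by
        have : gaugeSq g < K := hg
        linarith)
    simp [this]
  · have := integrableOn_gaugeSq_rpow_of_nonpos (n := n) (s := 0) (by
      have : (0 : ℝ) < n + 1 := by positivity
      linarith) le_rfl h
    simp only [Real.rpow_zero] at this
    simpa [integrableOn_const_iff, lt_top_iff_ne_top] using this

lemma integrableOn_gaugeSq_rpow {s : ℝ} (K : ℝ) (hs : -(n + 1 : ℝ) < s) :
    IntegrableOn (fun g : Hn n => gaugeSq g ^ s) {g | gaugeSq g < K} := by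
  rcases le_or_gt s 0 with h0 | h0
  · refine (integrableOn_gaugeSq_rpow_of_nonpos hs h0 (K := |K| + 1) (by positivity)).mono_set ?_
    intro g hg
    have : gaugeSq g < K := hg
    exact this.trans_le (by linarith [le_abs_self K])
  · refine Measure.integrableOn_of_bounded (M := K ^ s) (volume_gaugeSq_lt_ne_top K)
      (continuous_gaugeSq.measurable.pow_const s).aestronglyMeasurable ?_
    filter_upwards [ae_restrict_mem (isOpen_gaugeSq_lt K).measurableSet] with g hg
    rw [Real.norm_of_nonneg (Real.rpow_nonneg (gaugeSq_nonneg g) _)]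
    exact Real.rpow_le_rpow (gaugeSq_nonneg g) (le_of_lt hg) h0.le

/-- The function `|g|^β ψ(g)` with `β = 2p`, written in terms of `|g|²` and `|x|²`. -/
noncomputable def weight (p : ℝ) (g : Hn n) : ℝ := gaugeSq g ^ (p - 1) * horSq g

lemma weight_nonneg (p : ℝ) (g : Hn n) : 0 ≤ weight p g :=
  mul_nonneg (Real.rpow_nonneg (gaugeSq_nonneg g) _) (horSq_nonneg g)

lemma measurable_weight (p : ℝ) : Measurable (weight p : Hn n → ℝ) :=
  (continuous_gaugeSq.measurable.pow_const _).mul continuous_horSq.measurable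

lemma weight_of_gaugeSq_eq_zero (p : ℝ) {g : Hn n} (h : gaugeSq g = 0) : weight p g = 0 := by
  have : horSq g = 0 := le_antisymm (h ▸ horSq_le_gaugeSq g) (horSq_nonneg g)
  simp [weight, this]

lemma weight_le (p : ℝ) (g : Hn n) : weight p g ≤ gaugeSq g ^ p := by
  rcases (gaugeSq_nonneg g).eq_or_lt with h | h
  · rw [weight_of_gaugeSq_eq_zero p h.symm]
    exact Real.rpow_nonneg (gaugeSq_nonneg g) _
  · calc weight p g ≤ gaugeSq g ^ (p - 1) * gaugeSq g :=
          mul_le_mul_of_nonneg_left (horSq_le_gaugeSq g) (by positivity)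
      _ = gaugeSq g ^ p := by rw [← Real.rpow_add_one h.ne', sub_add_cancel]

lemma integrableOn_weight_rpow {p q : ℝ} (K : ℝ) (hq : 0 ≤ q) (hpq : -(n + 1 : ℝ) < p * q) :
    IntegrableOn (fun g : Hn n => weight p g ^ q) {g | gaugeSq g < K} := by
  refine Integrable.mono' (integrableOn_gaugeSq_rpow K hpq)
    ((measurable_weight p).pow_const q).aestronglyMeasurable (.of_forall fun g => ?_)
  rw [Real.norm_of_nonneg (Real.rpow_nonneg (weight_nonneg p g) _),
    Real.rpow_mul (gaugeSq_nonneg g)]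
  exact Real.rpow_le_rpow (weight_nonneg p g) (weight_le p g) hq

lemma integrableOn_weight {p : ℝ} (K : ℝ) (hp : -(n + 1 : ℝ) < p) :
    IntegrableOn (weight p : Hn n → ℝ) {g | gaugeSq g < K} := by
  simpa using integrableOn_weight_rpow (q := 1) K zero_le_one (by simpa using hp)

lemma weight_hdil (p : ℝ) {r : ℝ} (hr : 0 < r) (g : Hn n) :
    weight p (hdil r g) = (r ^ 2) ^ p * weight p g := by
  unfold weight
  rw [gaugeSq_hdil, horSq_hdil, Real.mul_rpow (sq_nonneg r) (gaugeSq_nonneg g),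
    Real.rpow_sub_one (by positivity)]
  field_simp

lemma rpow_le_of_comparable {x y a : ℝ} (s : ℝ) (hx : 0 < x) (hy : 0 < y) (ha : 0 < a)
    (hxy : x ≤ a * y) (hyx : y ≤ a * x) : x ^ s ≤ a ^ |s| * y ^ s := by
  rcases le_or_gt 0 s with hs | hs
  · rw [abs_of_nonneg hs, ← Real.mul_rpow ha.le hy.le]
    exact Real.rpow_le_rpow hx.le hxy hs
  · rw [abs_of_neg hs, Real.rpow_neg ha.le, ← Real.inv_rpow ha.le,
      ← Real.mul_rpow (by positivity) hy.le]
    refine Real.rpow_le_rpow_of_nonpos (by positivity) ?_ hs.le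
    rwa [inv_mul_le_iff₀ ha]

/-- The unit ball centred at the origin. -/
def unitBall (n : ℕ) : Set (Hn n) := {g | gaugeSq g < 1}

lemma isOpen_unitBall : IsOpen (unitBall n) := isOpen_gaugeSq_lt 1

lemma measurableSet_unitBall : MeasurableSet (unitBall n) := isOpen_unitBall.measurableSet

lemma volume_unitBall_ne_top : volume (unitBall n) ≠ ⊤ := volume_gaugeSq_lt_ne_top 1

lemma gaugeSq_zero : gaugeSq (0 : Hn n) = 0 := by simp [gaugeSq, horSq]

lemma volume_real_unitBall_pos : 0 < volume.real (unitBall n) :=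
  ENNReal.toReal_pos (isOpen_unitBall.measure_pos volume
    ⟨0, by simp [unitBall, gaugeSq_zero]⟩).ne' volume_unitBall_ne_top

lemma integrableOn_unitBall_horSq_hmul (g : Hn n) :
    IntegrableOn (fun k => horSq (hmul g k)) (unitBall n) := by
  refine Measure.integrableOn_of_bounded (M := 2 * horSq g + 2) volume_unitBall_ne_top
    (continuous_horSq.comp (continuous_hmul g)).aestronglyMeasurable ?_
  filter_upwards [ae_restrict_mem measurableSet_unitBall] with k hk
  rw [Real.norm_of_nonneg (horSq_nonneg _)]
  have hk1 : gaugeSq k < 1 := hk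
  linarith [horSq_hmul_le g k, horSq_le_gaugeSq k]

lemma integrableOn_unitBall_horSq : IntegrableOn (horSq : Hn n → ℝ) (unitBall n) := by
  simpa [hmul] using integrableOn_unitBall_horSq_hmul (0 : Hn n)

lemma measurePreserving_neg_volume :
    MeasurePreserving (Neg.neg : Hn n → Hn n) volume volume := by
  have : (volume : Measure (Hn n)).Regular :=
    Measure.Regular.of_sigmaCompactSpace_of_isLocallyFiniteMeasure _
  have : (volume : Measure (Hn n)).IsNegInvariant :=
    Measure.IsAddHaarMeasure.isNegInvariant_of_regular _
  exact Measure.measurePreserving_neg volume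

lemma integral_unitBall_horSq_hmul (g : Hn n) :
    ∫ k in unitBall n, horSq (hmul g k) =
      volume.real (unitBall n) * horSq g + ∫ k in unitBall n, horSq k := by
  have hneg : ∫ k in unitBall n, horSq (hmul g (-k)) = ∫ k in unitBall n, horSq (hmul g k) := by
    have hpre : Neg.neg ⁻¹' unitBall n = unitBall n := by
      ext k; simp [unitBall, gaugeSq_neg]
    have := measurePreserving_neg_volume.setIntegral_preimage_emb
      (Homeomorph.neg (Hn n)).measurableEmbedding (fun k => horSq (hmul g k)) (unitBall n)
    rwa [hpre] at this
  have hint := integrableOn_unitBall_horSq_hmul g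
  have hconst : IntegrableOn (fun _ => 2 * horSq g) (unitBall n) :=
    integrableOn_const volume_unitBall_ne_top
  have hintneg : IntegrableOn (fun k => horSq (hmul g (-k))) (unitBall n) := by
    refine ((hconst.add (integrableOn_unitBall_horSq.const_mul 2)).sub hint).congr
      (.of_forall fun k => ?_)
    simp only [Pi.add_apply, Pi.sub_apply]
    linarith [horSq_hmul_add_horSq_hmul_neg g k]
  have hsum : ∫ k in unitBall n, (horSq (hmul g k) + horSq (hmul g (-k))) =
      ∫ k in unitBall n, (2 * horSq g + 2 * horSq k) := by
    simp_rw [horSq_hmul_add_horSq_hmul_neg]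
  rw [integral_add hint hintneg, hneg,
    integral_add hconst (integrableOn_unitBall_horSq.const_mul 2),
    setIntegral_const, integral_const_mul, smul_eq_mul] at hsum
  linarith

lemma integral_unitBall_horSq_pos (hn : 0 < n) : 0 < ∫ k in unitBall n, horSq k := by
  rw [setIntegral_pos_iff_support_of_nonneg_ae (.of_forall horSq_nonneg)
    integrableOn_unitBall_horSq]
  refine ((continuous_horSq.isOpen_support).inter isOpen_unitBall).measure_pos volume ?_
  refine ⟨(Pi.single ⟨0, hn⟩ (1 / 2), 0, 0), ?_, ?_⟩ <;>
  norm_num [unitBall, gaugeSq, horSq, Pi.single_apply, ite_pow]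

lemma exists_le_integral_horSq_hmul (hn : 0 < n) :
    ∃ c > 0, ∀ g : Hn n, c * (horSq g + 1) ≤ ∫ k in unitBall n, horSq (hmul g k) := by
  have h1 := volume_real_unitBall_pos (n := n)
  have h2 := integral_unitBall_horSq_pos hn
  refine ⟨min (volume.real (unitBall n)) (∫ k in unitBall n, horSq k), lt_min h1 h2, fun g => ?_⟩
  rw [integral_unitBall_horSq_hmul, mul_add, mul_one]
  exact add_le_add (mul_le_mul_of_nonneg_right (min_le_left _ _) (horSq_nonneg g))
    (min_le_right _ _)

lemma gaugeSq_hmul_comparable {g k : Hn n} (hg : 6 ≤ gaugeSq g) (hk : k ∈ unitBall n) :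
    0 < gaugeSq (hmul g k) ∧ gaugeSq (hmul g k) ≤ 16 * (gaugeSq g + 1) ∧
      gaugeSq g + 1 ≤ 16 * gaugeSq (hmul g k) := by
  have hk1 : gaugeSq k < 1 := hk
  have h1 := gaugeSq_hmul_le g k
  have h2 := gaugeSq_le_hmul g k
  refine ⟨?_, ?_, ?_⟩ <;> linarith

lemma integral_unitBall_comp_hmul_le {f : Hn n → ℝ} (hf : ∀ g, 0 ≤ f g) (hfm : Measurable f)
    (hfi : ∀ K, IntegrableOn f {g | gaugeSq g < K}) (g : Hn n) :
    IntegrableOn (fun k => f (hmul g k)) (unitBall n) ∧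
      ∫ k in unitBall n, f (hmul g k) ≤ ∫ h in {h | gaugeSq h < 4 * (gaugeSq g + 1)}, f h := by
  set s := {h : Hn n | gaugeSq h < 4 * (gaugeSq g + 1)} with hs
  have hms : MeasurableSet s := (isOpen_gaugeSq_lt _).measurableSet
  have hmp := measurePreserving_hmul g
  have hsub : unitBall n ⊆ hmul g ⁻¹' s := fun k hk => by
    have hk1 : gaugeSq k < 1 := hk
    have := gaugeSq_hmul_le g k
    simp only [hs, Set.mem_preimage, Set.mem_ofPred_eq]
    linarith
  have hi : IntegrableOn (fun k => f (hmul g k)) (hmul g ⁻¹' s) :=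
    ((hmp.restrict_preimage hms).integrable_comp hfm.aestronglyMeasurable).2 (hfi _)
  refine ⟨hi.mono_set hsub, ?_⟩
  have heq : ∫ k in hmul g ⁻¹' s, f (hmul g k) = ∫ h in s, f h := by
    rw [← setIntegral_map hms hfm.aestronglyMeasurable hmp.measurable.aemeasurable, hmp.map_eq]
  rw [← heq]
  exact setIntegral_mono_set hi (.of_forall fun k => hf _) hsub.eventuallyLE

lemma exists_integral_weight_rpow_le {p q : ℝ} (hq : 0 < q) (hpq : -(n + 1 : ℝ) < p * q) :
    ∃ C > 0, ∀ g : Hn n, ∫ k in unitBall n, weight p (hmul g k) ^ q ≤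
      C * ((gaugeSq g + 1) ^ (p - 1) * (horSq g + 1)) ^ q := by
  set I := ∫ h in {h : Hn n | gaugeSq h < 28}, weight p h ^ q with hI
  have hI0 : 0 ≤ I := integral_nonneg fun h => Real.rpow_nonneg (weight_nonneg p h) q
  set A : ℝ := (16 ^ |p - 1| * 2) ^ q * volume.real (unitBall n) with hA
  have hA0 : 0 < A := mul_pos (by positivity) volume_real_unitBall_pos
  set D : ℝ := 7 ^ |p - 1| with hD
  have hD0 : 0 < D := by positivity
  refine ⟨A + I * D ^ q, by positivity, fun g => ?_⟩
  have hw := horSq_nonneg g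
  have hM := gaugeSq_nonneg g
  have hintf (K : ℝ) := integrableOn_weight_rpow (n := n) K hq.le hpq
  have hcomp := integral_unitBall_comp_hmul_le
    (fun h => Real.rpow_nonneg (weight_nonneg p h) q) ((measurable_weight p).pow_const q) hintf g
  have hE : 0 ≤ ((gaugeSq g + 1) ^ (p - 1) * (horSq g + 1)) ^ q := by positivity
  rw [add_mul]
  rcases le_or_gt 6 (gaugeSq g) with h6 | h6
  · refine le_add_of_le_of_nonneg ?_ (by positivity)
    calc ∫ k in unitBall n, weight p (hmul g k) ^ q
        ≤ ∫ _ in unitBall n,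
          (16 ^ |p - 1| * (gaugeSq g + 1) ^ (p - 1) * (2 * (horSq g + 1))) ^ q := by
          refine setIntegral_mono_on hcomp.1 (integrableOn_const volume_unitBall_ne_top)
            measurableSet_unitBall fun k hk => ?_
          obtain ⟨h1, h2, h3⟩ := gaugeSq_hmul_comparable h6 hk
          have hk1 : gaugeSq k < 1 := hk
          refine Real.rpow_le_rpow (weight_nonneg _ _) ?_ hq.le
          refine mul_le_mul (rpow_le_of_comparable _ h1 (by linarith) (by norm_num) h2 h3) ?_
            (horSq_nonneg _) (by positivity)
          linarith [horSq_hmul_le g k, horSq_le_gaugeSq k]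
      _ = A * ((gaugeSq g + 1) ^ (p - 1) * (horSq g + 1)) ^ q := by
          rw [setIntegral_const, smul_eq_mul, hA, mul_right_comm (_ ^ q),
            ← Real.mul_rpow (by positivity) (by positivity), mul_comm]
          congr 2
          ring
  · refine le_add_of_nonneg_of_le (by positivity) ?_
    have hD1 : 1 ≤ D * ((gaugeSq g + 1) ^ (p - 1) * (horSq g + 1)) := by
      have h1 := rpow_le_of_comparable (p - 1) one_pos (y := gaugeSq g + 1) (a := 7)
        (by linarith) (by norm_num) (by linarith) (by linarith)
      rw [Real.one_rpow] at h1
      rw [← mul_assoc]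
      nlinarith
    calc ∫ k in unitBall n, weight p (hmul g k) ^ q ≤ I := by
          refine hcomp.2.trans (setIntegral_mono_set (hintf 28)
            (.of_forall fun h => Real.rpow_nonneg (weight_nonneg p h) q)
            (LE.le.eventuallyLE fun h hh => ?_))
          simp only [Set.mem_ofPred_eq] at hh ⊢
          linarith
      _ ≤ I * (D * ((gaugeSq g + 1) ^ (p - 1) * (horSq g + 1))) ^ q :=
          le_mul_of_one_le_right hI0 (Real.one_le_rpow hD1 hq.le)
      _ = I * D ^ q * ((gaugeSq g + 1) ^ (p - 1) * (horSq g + 1)) ^ q := by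
          rw [Real.mul_rpow hD0.le (by positivity), mul_assoc]

lemma rpow_mul_horSq_le_weight {p a : ℝ} {g : Hn n}
    (h : 0 < gaugeSq g → a ≤ gaugeSq g ^ (p - 1)) : a * horSq g ≤ weight p g := by
  rcases (gaugeSq_nonneg g).eq_or_lt with h0 | h0
  · have hw : horSq g = 0 := le_antisymm (h0 ▸ horSq_le_gaugeSq g) (horSq_nonneg g)
    simp [weight, hw]
  · exact mul_le_mul_of_nonneg_right (h h0) (horSq_nonneg g)

lemma rpow_mul_sub_le_weight {p ε : ℝ} (hp : 1 ≤ p) (hε : 0 < ε) (g : Hn n) :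
    ε ^ (p - 1) * (horSq g - ε) ≤ weight p g := by
  rcases le_or_gt (horSq g) ε with h | h
  · exact (mul_nonpos_of_nonneg_of_nonpos (by positivity) (by linarith)).trans (weight_nonneg p g)
  · refine mul_le_mul (Real.rpow_le_rpow hε.le (h.le.trans (horSq_le_gaugeSq g)) (by linarith))
      (by linarith) (by linarith) (Real.rpow_nonneg (gaugeSq_nonneg g) _)

lemma exists_le_integral_weight (hn : 0 < n) {p : ℝ} (hp : -(n + 1 : ℝ) < p) :
    ∃ c > 0, ∀ g : Hn n, c * ((gaugeSq g + 1) ^ (p - 1) * (horSq g + 1)) ≤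
      ∫ k in unitBall n, weight p (hmul g k) := by
  obtain ⟨c, hc, hcg⟩ := exists_le_integral_horSq_hmul hn
  have hint (g : Hn n) := (integral_unitBall_comp_hmul_le (weight_nonneg p)
    (measurable_weight p) (fun K => integrableOn_weight K hp) g).1
  have of_le {g : Hn n} {b : ℝ} (hb : 0 ≤ b)
      (h : ∀ k ∈ unitBall n, 0 < gaugeSq (hmul g k) →
        b * (gaugeSq g + 1) ^ (p - 1) ≤ gaugeSq (hmul g k) ^ (p - 1)) :
      b * c * ((gaugeSq g + 1) ^ (p - 1) * (horSq g + 1)) ≤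
        ∫ k in unitBall n, weight p (hmul g k) := by
    have hM := gaugeSq_nonneg g
    calc b * c * ((gaugeSq g + 1) ^ (p - 1) * (horSq g + 1))
        = b * (gaugeSq g + 1) ^ (p - 1) * (c * (horSq g + 1)) := by ring
      _ ≤ b * (gaugeSq g + 1) ^ (p - 1) * ∫ k in unitBall n, horSq (hmul g k) :=
          mul_le_mul_of_nonneg_left (hcg g) (by positivity)
      _ = ∫ k in unitBall n, b * (gaugeSq g + 1) ^ (p - 1) * horSq (hmul g k) :=
          (integral_const_mul _ _).symm
      _ ≤ _ := setIntegral_mono_on ((integrableOn_unitBall_horSq_hmul g).const_mul _) (hint g)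
          measurableSet_unitBall fun k hk => rpow_mul_horSq_le_weight (h k hk)
  rcases le_or_gt p 1 with hp1 | hp1
  · refine ⟨4 ^ (p - 1) * c, by positivity, fun g => of_le (by positivity) fun k hk h0 => ?_⟩
    have hk1 : gaugeSq k < 1 := hk
    have hM := gaugeSq_nonneg g
    rw [← Real.mul_rpow (by norm_num) (by linarith)]
    exact Real.rpow_le_rpow_of_nonpos h0 (by linarith [gaugeSq_hmul_le g k]) (by linarith)
  · set m := volume.real (unitBall n) with hm
    have hm0 : 0 < m := volume_real_unitBall_pos
    set ε := c / (2 * m) with hε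
    have hε0 : 0 < ε := by positivity
    set b₁ : ℝ := 16⁻¹ ^ (p - 1) * c with hb₁
    set b₂ : ℝ := ε ^ (p - 1) * (c / 2) * (7 ^ (p - 1))⁻¹ with hb₂
    refine ⟨min b₁ b₂, lt_min (by positivity) (by positivity), fun g => ?_⟩
    have hM := gaugeSq_nonneg g
    have hw := horSq_nonneg g
    have hE : 0 ≤ (gaugeSq g + 1) ^ (p - 1) * (horSq g + 1) := by positivity
    rcases le_or_gt 6 (gaugeSq g) with h6 | h6
    · refine (mul_le_mul_of_nonneg_right (min_le_left _ _) hE).trans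
        (of_le (by positivity) fun k hk h0 => ?_)
      obtain ⟨-, -, h3⟩ := gaugeSq_hmul_comparable h6 hk
      rw [← Real.mul_rpow (by norm_num) (by linarith)]
      exact Real.rpow_le_rpow (by positivity) (by linarith) (by linarith)
    · refine (mul_le_mul_of_nonneg_right (min_le_right _ _) hE).trans ?_
      have hS : (7 ^ (p - 1))⁻¹ * (gaugeSq g + 1) ^ (p - 1) ≤ 1 := by
        rw [inv_mul_le_one₀ (by positivity)]
        exact Real.rpow_le_rpow (by positivity) (by linarith) (by linarith)
      have hεm : ε * m = c / 2 := by rw [hε]; field_simp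
      calc b₂ * ((gaugeSq g + 1) ^ (p - 1) * (horSq g + 1))
          = ε ^ (p - 1) * (c / 2) * (horSq g + 1) *
              ((7 ^ (p - 1))⁻¹ * (gaugeSq g + 1) ^ (p - 1)) := by rw [hb₂]; ring
        _ ≤ ε ^ (p - 1) * (c / 2) * (horSq g + 1) :=
            mul_le_of_le_one_right (by positivity) hS
        _ = ε ^ (p - 1) * (c / 2 * (horSq g + 1)) := by ring
        _ ≤ ε ^ (p - 1) * ((∫ k in unitBall n, horSq (hmul g k)) - m * ε) := by
            refine mul_le_mul_of_nonneg_left ?_ (by positivity)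
            nlinarith [hcg g]
        _ = ∫ k in unitBall n, ε ^ (p - 1) * (horSq (hmul g k) - ε) := by
            rw [integral_const_mul, integral_sub (integrableOn_unitBall_horSq_hmul g)
              (integrableOn_const volume_unitBall_ne_top), setIntegral_const, smul_eq_mul]
        _ ≤ _ := setIntegral_mono_on
            (((integrableOn_unitBall_horSq_hmul g).sub
              (integrableOn_const volume_unitBall_ne_top)).const_mul _) (hint g)
            measurableSet_unitBall fun k _ => rpow_mul_sub_le_weight hp1.le hε0 _

lemma mem_ball_iff {g h : Hn n} {r : ℝ} (hr : 0 < r) :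
    h ∈ ball g r ↔ gaugeSq (hmul (hinv g) h) < r ^ 2 := by
  rw [← hnorm_sq]
  exact (pow_lt_pow_iff_left₀ (hnorm_nonneg _) hr.le two_ne_zero).symm

lemma ball_subset {g : Hn n} {r : ℝ} (hr : 0 < r) :
    ball g r ⊆ {h | gaugeSq h < 4 * (gaugeSq g + r ^ 2)} := fun h hh => by
  have h1 := gaugeSq_hmul_le g (hmul (hinv g) h)
  rw [hmul_hinv_cancel_left] at h1
  have h2 := (mem_ball_iff hr).1 hh
  simp only [Set.mem_ofPred_eq]
  linarith

lemma isOpen_ball (g : Hn n) {r : ℝ} (hr : 0 < r) : IsOpen (ball g r) := by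
  have : ball g r = {h | gaugeSq (hmul (hinv g) h) < r ^ 2} := Set.ext fun h => mem_ball_iff hr
  rw [this]
  exact isOpen_lt (continuous_gaugeSq.comp (continuous_hmul _)) continuous_const

lemma continuous_hdil (r : ℝ) : Continuous (hdil r : Hn n → Hn n) := by
  unfold hdil; fun_prop

lemma hdil_hdil_inv {r : ℝ} (hr : r ≠ 0) (g : Hn n) : hdil r (hdil r⁻¹ g) = g := by
  simp [hdil, smul_smul, hr]

/-- Averages over `B(g, r)` are averages over the unit ball after translation and dilation. -/
lemma average_ball_eq {f : Hn n → ℝ} (hf : Measurable f) (g : Hn n) {r : ℝ} (hr : 0 < r) :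
    ((volume (ball g r)).toReal)⁻¹ * ∫ h in ball g r, f h =
      (volume.real (unitBall n))⁻¹ *
        ∫ k in unitBall n, f (hdil r (hmul (hdil r⁻¹ g) k)) := by
  obtain ⟨c, hc, hmap⟩ := exists_map_hdil (n := n) hr
  set g' := hdil r⁻¹ g with hg'
  have hmp := measurePreserving_hmul g'
  have hT : Measurable fun k => hdil r (hmul g' k) :=
    ((continuous_hdil r).comp (continuous_hmul g')).measurable
  have hTmap : (volume : Measure (Hn n)).map (fun k => hdil r (hmul g' k)) =
      ENNReal.ofReal c • volume := by
    rw [← hmap, ← hmp.map_eq, Measure.map_map (continuous_hdil r).measurable hmp.measurable,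
      hmp.map_eq]
    rfl
  have hball := (isOpen_ball g hr).measurableSet
  have hpre : (fun k => hdil r (hmul g' k)) ⁻¹' ball g r = unitBall n := by
    ext k
    rw [Set.mem_preimage, mem_ball_iff hr]
    nth_rewrite 1 [← hdil_hdil_inv hr.ne' g]
    rw [hinv_hdil_hmul_hdil, gaugeSq_hdil]
    exact mul_lt_iff_lt_one_right (by positivity)
  have hvol : volume.real (unitBall n) = c * (volume (ball g r)).toReal := by
    rw [Measure.real, ← hpre, ← Measure.map_apply hT hball, hTmap, Measure.smul_apply,
      smul_eq_mul, ENNReal.toReal_mul, ENNReal.toReal_ofReal hc.le]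
  have hint : ∫ k in unitBall n, f (hdil r (hmul g' k)) = c * ∫ h in ball g r, f h := by
    rw [← hpre, ← setIntegral_map hball hf.aestronglyMeasurable hT.aemeasurable, hTmap,
      Measure.restrict_smul, integral_smul_measure, ENNReal.toReal_ofReal hc.le, smul_eq_mul]
  rw [hvol, hint]
  field_simp

/-- Lemma 22: for `1 < q < ∞` and `-Q/q < β`, the function
`g ↦ |g|^β ψ(g)` belongs to the reverse Hölder class `B_q`. -/
theorem psi_power_revHolder (n : ℕ) (q β : ℝ) (hq : 1 < q)
    (hβ : -(Qd n) / q < β) :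
    RevHolder n (fun g => hnorm g ^ β * psi g) q := by
  have hV : (fun g : Hn n => hnorm g ^ β * psi g) = weight (β / 2) :=
    funext fun g => hnorm_rpow_mul_psi β g
  rw [hV]
  set p := β / 2 with hp
  have hq0 : 0 < q := by linarith
  have hN : (0 : ℝ) < n + 1 := by positivity
  have hpq : -(n + 1 : ℝ) < p * q := by
    rw [div_lt_iff₀ hq0, Qd] at hβ
    rw [hp]; linarith
  have hp1 : -(n + 1 : ℝ) < p := by
    rcases le_or_gt 0 p with h | h
    · linarith
    · nlinarith
  refine ⟨weight_nonneg p,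
    fun g r hr => (integrableOn_weight_rpow _ hq0.le hpq).mono_set (ball_subset hr),
    fun g r hr => (integrableOn_weight _ hp1).mono_set (ball_subset hr), ?_⟩
  rcases Nat.eq_zero_or_pos n with rfl | hn
  · have h0 : (weight p : Hn 0 → ℝ) = fun _ => 0 := by
      ext g; simp [weight, horSq]
    exact ⟨1, one_pos, fun g r hr => by
      simp [h0, Real.zero_rpow hq0.ne', Real.zero_rpow (inv_pos.2 hq0).ne']⟩
  obtain ⟨C, hC, hup⟩ := exists_integral_weight_rpow_le (n := n) hq0 hpq
  obtain ⟨c, hc, hlow⟩ := exists_le_integral_weight hn hp1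
  set m := volume.real (unitBall n) with hm
  have hm0 : 0 < m := volume_real_unitBall_pos
  refine ⟨(m⁻¹ * C) ^ (1 / q) * (m / c), by positivity, fun g r hr => ?_⟩
  rw [average_ball_eq ((measurable_weight p).pow_const q) g hr,
    average_ball_eq (measurable_weight p) g hr]
  set g' := hdil r⁻¹ g with hg'
  set E := (gaugeSq g' + 1) ^ (p - 1) * (horSq g' + 1) with hE
  have hE0 : 0 ≤ E := by
    have := gaugeSq_nonneg g'
    have := horSq_nonneg g'
    positivity
  set a : ℝ := (r ^ 2) ^ p with ha
  have ha0 : 0 < a := by positivity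
  have hpow (h : Hn n) : (a * weight p h) ^ q = a ^ q * weight p h ^ q :=
    Real.mul_rpow ha0.le (weight_nonneg p h)
  simp_rw [weight_hdil p hr, ← ha, hpow]
  rw [integral_const_mul, integral_const_mul]
  have hint0 : 0 ≤ ∫ k in unitBall n, weight p (hmul g' k) ^ q :=
    integral_nonneg fun k => Real.rpow_nonneg (weight_nonneg p _) q
  calc (m⁻¹ * (a ^ q * ∫ k in unitBall n, weight p (hmul g' k) ^ q)) ^ (1 / q)
      ≤ (m⁻¹ * (a ^ q * (C * E ^ q))) ^ (1 / q) := by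
        refine Real.rpow_le_rpow (by positivity) ?_ (by positivity)
        have := hup g'
        gcongr
    _ = (m⁻¹ * C) ^ (1 / q) * (a * E) := by
        rw [show m⁻¹ * (a ^ q * (C * E ^ q)) = m⁻¹ * C * (a ^ q * E ^ q) by ring,
          ← Real.mul_rpow ha0.le hE0, Real.mul_rpow (by positivity) (by positivity),
          ← Real.rpow_mul (by positivity), mul_one_div_cancel hq0.ne', Real.rpow_one]
    _ = (m⁻¹ * C) ^ (1 / q) * (m / c) * (m⁻¹ * (a * (c * E))) := by
        field_simp
    _ ≤ _ := by
        have := hlow g'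
        gcongr

end Heisenberg
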